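/- Let (G,P) = Γ_{I∈Λ}(G_I,P_I) be a graph product of quasi-lattice ordered groups. Given any pair u, v ∈ P there exist a, b ∈ P satisfying: (i) ab⁻¹ = uv⁻¹, a ≤ u, b ≤ v, and a_Iʳ ∧ᵣ b_Iʳ = 1 in (G_I,P_I) for all I ∈ Δʳ(a) ∩ Δʳ(b); and (ii) writing reduced expressions A·(∏_{I∈Δʳ(a)∩Δʳ(b)} a_Iʳ) for a and (∏_{I∈Δʳ(a)∩Δʳ(b)} (b_Iʳ)⁻¹)·B for b⁻¹, the expression A·[∏_{I∈Δʳ(a)∩Δʳ(b)} (a_Iʳ (b_Iʳ)⁻¹)]·B is a reduced expression for ab⁻¹. -/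

import Mathlib

universe u v

/-- A syllable: a vertex `I` of the graph together with a nontrivial element of `G I`. -/
def Syllable {Λ : Type u} (G : Λ → Type v) [∀ I, Group (G I)] : Type (max u v) :=
  Σ I : Λ, {g : G I // g ≠ 1}

section Words

variable {Λ : Type u} {G : Λ → Type v} [∀ I, Group (G I)]

/-- A single shuffle: swap two consecutive syllables with adjacent vertices. -/
def ShuffleStep (adj : Λ → Λ → Prop) (L L' : List (Syllable G)) : Prop :=
  ∃ (A B : List (Syllable G)) (s t : Syllable G),
    adj s.1 t.1 ∧ L = A ++ s :: t :: B ∧ L' = A ++ t :: s :: B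

/-- Shuffle equivalence: finitely many shuffles. -/
def ShuffleEquiv (adj : Λ → Λ → Prop) : List (Syllable G) → List (Syllable G) → Prop :=
  Relation.ReflTransGen (ShuffleStep adj)

/-- An expression admits an amalgamation iff it has two consecutive syllables at the
same vertex. -/
def Amalgamable (L : List (Syllable G)) : Prop :=
  ∃ (A B : List (Syllable G)) (s t : Syllable G), s.1 = t.1 ∧ L = A ++ s :: t :: B

/-- An expression is reduced iff it is not shuffle equivalent to an expression
admitting an amalgamation. -/
def Reduced (adj : Λ → Λ → Prop) (L : List (Syllable G)) : Prop :=
  ¬ ∃ L', ShuffleEquiv adj L L' ∧ Amalgamable L'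

/-- The syllable at position `i` is an initial syllable of the expression `L`:
its vertex is adjacent to the vertices of all earlier syllables. -/
def InitialAt (adj : Λ → Λ → Prop) (L : List (Syllable G)) (i : Fin L.length) : Prop :=
  ∀ j : Fin L.length, j < i → adj (L.get j).1 (L.get i).1

end Words

section GroupPart

variable {Λ : Type u} (adj : Λ → Λ → Prop) (G : Λ → Type v) [∀ I, Group (G I)]

/-- The graph product of the family of groups `G` over the graph `adj`: the quotient of
the free product by the normal closure of the commutators coming from adjacent vertices. -/
def GraphProduct : Type (max u v) :=
  Monoid.CoprodI G ⧸ Subgroup.normalClosure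
    {g : Monoid.CoprodI G | ∃ (I J : Λ) (x : G I) (y : G J), adj I J ∧
      g = Monoid.CoprodI.of x * Monoid.CoprodI.of y *
          (Monoid.CoprodI.of x)⁻¹ * (Monoid.CoprodI.of y)⁻¹}

instance : Group (GraphProduct adj G) :=
  inferInstanceAs (Group (_ ⧸ _))

/-- The canonical image in the graph product of an element of one of the groups. -/
def mkOf {I : Λ} (g : G I) : GraphProduct adj G :=
  QuotientGroup.mk (Monoid.CoprodI.of g)

/-- Evaluation of an expression (a word in the syllables) in the graph product. -/
def evalWord (L : List (Syllable G)) : GraphProduct adj G :=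
  (L.map fun s => mkOf adj G (s.2.1 : G s.1)).prod

/-- `L` is an expression for the group element `x`. -/
def ExprFor (L : List (Syllable G)) (x : GraphProduct adj G) : Prop :=
  evalWord adj G L = x

/-- `s` is an initial syllable of the group element `x`: some reduced expression for `x`
has `s` as an initial syllable. -/
def IsInitialSyllable (x : GraphProduct adj G) (s : Syllable G) : Prop :=
  ∃ L, Reduced adj L ∧ ExprFor adj G L x ∧ ∃ i : Fin L.length, InitialAt adj L i ∧ L.get i = s

/-- `s` is a final syllable of the group element `x`: it is an initial syllable of the
reverse of some reduced expression for `x`. -/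
def IsFinalSyllable (x : GraphProduct adj G) (s : Syllable G) : Prop :=
  ∃ L, Reduced adj L ∧ ExprFor adj G L x ∧
    ∃ i : Fin L.reverse.length, InitialAt adj L.reverse i ∧ L.reverse.get i = s

/-- `I` is an initial vertex of the group element `x`, i.e. `I ∈ Δ(x)`. -/
def InitialVertexOf (x : GraphProduct adj G) (I : Λ) : Prop :=
  ∃ s : Syllable G, IsInitialSyllable adj G x s ∧ s.1 = I

/-- `I` is a final vertex of the group element `x`, i.e. `I ∈ Δʳ(x)`. -/
def FinalVertexOf (x : GraphProduct adj G) (I : Λ) : Prop :=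
  ∃ s : Syllable G, IsFinalSyllable adj G x s ∧ s.1 = I

/-- `I` is a vertex of the group element `x`: some (hence any) reduced expression
for `x` has a syllable at the vertex `I`. -/
def VertexOf (x : GraphProduct adj G) (I : Λ) : Prop :=
  ∃ L, Reduced adj L ∧ ExprFor adj G L x ∧ ∃ s ∈ L, Sigma.fst s = I

/-- `c` is the element `x_I ∈ G_I`: either `c` is nontrivial and the initial syllable of
`x` at the vertex `I`, or `c = 1` and `I` is not an initial vertex of `x`. -/
def InitialPart (x : GraphProduct adj G) (I : Λ) (c : G I) : Prop :=
  (∃ h : c ≠ 1, IsInitialSyllable adj G x ⟨I, ⟨c, h⟩⟩) ∨ (c = 1 ∧ ¬ InitialVertexOf adj G x I)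

/-- The positive cone of the graph product of partially ordered groups: the submonoid
generated by the union of the positive cones of the factors. -/
def posCone (Pc : ∀ I, Submonoid (G I)) : Submonoid (GraphProduct adj G) :=
  Submonoid.closure {g | ∃ (I : Λ) (p : G I), p ∈ Pc I ∧ g = mkOf adj G p}

end GroupPart

section Order

variable {H : Type*} [Group H]

/-- `x ≤ y` in the left-invariant partial order determined by the cone `P`. -/
def lle (P : Submonoid H) (x y : H) : Prop := x⁻¹ * y ∈ P

/-- `x ≤ᵣ y` in the right-invariant partial order determined by the cone `P`. -/
def rle (P : Submonoid H) (x y : H) : Prop := y * x⁻¹ ∈ P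

/-- `x` and `y` have a common upper bound for the left-invariant order. -/
def HasUB (P : Submonoid H) (x y : H) : Prop := ∃ z, lle P x z ∧ lle P y z

/-- `m` is a least upper bound of `x` and `y` for the left-invariant order. -/
def IsLub' (P : Submonoid H) (x y m : H) : Prop :=
  lle P x m ∧ lle P y m ∧ ∀ w, lle P x w → lle P y w → lle P m w

/-- `w` is a greatest lower bound of `u` and `v` for the right-invariant order. -/
def IsRGlb (P : Submonoid H) (u v w : H) : Prop :=
  rle P w u ∧ rle P w v ∧ ∀ z, rle P z u → rle P z v → rle P z w

/-- `(H,P)` is a partially ordered group: `P ∩ P⁻¹ = {1}`. -/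
def IsPoGroup (P : Submonoid H) : Prop := ∀ x : H, x ∈ P → x⁻¹ ∈ P → x = 1

/-- `(H,P)` is a quasi-lattice ordered group: it is a partially ordered group in which
every pair of elements with a common upper bound has a least upper bound. -/
def IsQLO (P : Submonoid H) : Prop :=
  IsPoGroup P ∧ ∀ x y : H, HasUB P x y → ∃ m, IsLub' P x y m

end Order

/-- Turn a list `Ds` of vertices and a family of elements `f I ∈ G I`, nontrivial on
`Ds`, into the expression `∏_{I ∈ Ds} f I` (one syllable for each entry of `Ds`). -/
def sylList {Λ : Type u} {G : Λ → Type v} [∀ I, Group (G I)]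
    (Ds : List Λ) (f : ∀ I : Λ, G I) (h : ∀ I ∈ Ds, f I ≠ 1) : List (Syllable G) :=
  Ds.attach.map fun I => ⟨I.1, ⟨f I.1, h I.1 I.2⟩⟩


section Shuffle

attribute [reducible] Syllable

variable {Λ : Type u} {G : Λ → Type v} [∀ I, Group (G I)] {adj : Λ → Λ → Prop}

theorem ShuffleEquiv.append_left {L L' : List (Syllable G)} (C : List (Syllable G))
    (h : ShuffleEquiv adj L L') : ShuffleEquiv adj (C ++ L) (C ++ L') := by
  refine Relation.ReflTransGen.lift (C ++ ·) (fun _ _ => ?_) _ _ h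
  rintro ⟨A, B, s, t, hst, rfl, rfl⟩
  exact ⟨C ++ A, B, s, t, hst, by simp, by simp⟩

theorem ShuffleEquiv.append_right {L L' : List (Syllable G)} (C : List (Syllable G))
    (h : ShuffleEquiv adj L L') : ShuffleEquiv adj (L ++ C) (L' ++ C) := by
  refine Relation.ReflTransGen.lift (· ++ C) (fun _ _ => ?_) _ _ h
  rintro ⟨A, B, s, t, hst, rfl, rfl⟩
  exact ⟨A, B ++ C, s, t, hst, by simp, by simp⟩

theorem ShuffleEquiv.cons {L L' : List (Syllable G)} (s : Syllable G)
    (h : ShuffleEquiv adj L L') : ShuffleEquiv adj (s :: L) (s :: L') :=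
  h.append_left [s]

theorem ShuffleEquiv.swap {s t : Syllable G} (h : adj s.1 t.1) (L : List (Syllable G)) :
    ShuffleEquiv adj (s :: t :: L) (t :: s :: L) :=
  Relation.ReflTransGen.single ⟨[], L, s, t, h, rfl, rfl⟩

theorem ShuffleEquiv.trans {L M N : List (Syllable G)} (h : ShuffleEquiv adj L M)
    (h' : ShuffleEquiv adj M N) : ShuffleEquiv adj L N :=
  Relation.ReflTransGen.trans h h'

theorem ShuffleEquiv.symm (hsymm : ∀ ⦃I J⦄, adj I J → adj J I) {L L' : List (Syllable G)}
    (h : ShuffleEquiv adj L L') : ShuffleEquiv adj L' L := by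
  have : Std.Symm (ShuffleStep (G := G) adj) := by
    refine ⟨?_⟩
    rintro _ _ ⟨A, B, s, t, hst, rfl, rfl⟩
    exact ⟨A, B, t, s, hsymm hst, rfl, rfl⟩
  exact Std.Symm.symm (r := Relation.ReflTransGen (ShuffleStep adj)) _ _ h

theorem ShuffleEquiv.perm {L L' : List (Syllable G)} (h : ShuffleEquiv adj L L') :
    L.Perm L' := by
  induction h with
  | refl => rfl
  | tail _ h ih =>
    obtain ⟨A, B, s, t, -, rfl, rfl⟩ := h
    exact ih.trans ((List.Perm.swap t s B).append_left A)

theorem ShuffleEquiv.reverse (hsymm : ∀ ⦃I J⦄, adj I J → adj J I) {L L' : List (Syllable G)}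
    (h : ShuffleEquiv adj L L') : ShuffleEquiv adj L.reverse L'.reverse := by
  refine Relation.ReflTransGen.lift List.reverse (fun _ _ => ?_) _ _ h
  rintro ⟨A, B, s, t, hst, rfl, rfl⟩
  exact ⟨B.reverse, A.reverse, t, s, hsymm hst, by simp, by simp⟩

theorem shuffleEquiv_cons_of_adj {s : Syllable G} {Q : List (Syllable G)}
    (h : ∀ t ∈ Q, adj s.1 t.1) : ShuffleEquiv adj (s :: Q) (Q ++ [s]) := by
  induction Q with
  | nil => exact .refl
  | cons q Q ih =>
    exact (ShuffleEquiv.swap (h q (by simp)) Q).trans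
      ((ih fun t ht => h t (by simp [ht])).cons q)

/-- Shuffles only see the vertices of the syllables. -/
theorem ShuffleEquiv.exists_lift {L L' M : List (Syllable G)}
    (hL : L.map Sigma.fst = L'.map Sigma.fst) (h : ShuffleEquiv adj L M) :
    ∃ M', ShuffleEquiv adj L' M' ∧ M.map Sigma.fst = M'.map Sigma.fst := by
  induction h with
  | refl => exact ⟨L', .refl, hL⟩
  | tail _ h ih =>
    obtain ⟨A, B, s, t, hst, rfl, rfl⟩ := h
    obtain ⟨M', hM', e⟩ := ih
    rw [List.map_append, List.map_cons, List.map_cons, eq_comm] at e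
    obtain ⟨A', R, rfl, eA, e⟩ := List.map_eq_append_iff.1 e
    obtain ⟨s', R, rfl, es, e⟩ := List.map_eq_cons_iff.1 e
    obtain ⟨t', B', rfl, et, eB⟩ := List.map_eq_cons_iff.1 e
    refine ⟨A' ++ t' :: s' :: B', hM'.trans (.single ⟨A', B', s', t', ?_, rfl, rfl⟩), ?_⟩
    · rwa [es, et]
    · simp [eA, es, et, eB]

theorem Reduced.of_map_fst_eq {L L' : List (Syllable G)}
    (hL : L.map Sigma.fst = L'.map Sigma.fst) (h : Reduced adj L) : Reduced adj L' := by
  rintro ⟨M, hM, A, B, s, t, hst, rfl⟩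
  obtain ⟨M', hM', e⟩ := hM.exists_lift hL.symm
  rw [List.map_append, List.map_cons, List.map_cons, eq_comm] at e
  obtain ⟨A', R, rfl, eA, e⟩ := List.map_eq_append_iff.1 e
  obtain ⟨s', R, rfl, es, e⟩ := List.map_eq_cons_iff.1 e
  obtain ⟨t', B', rfl, et, eB⟩ := List.map_eq_cons_iff.1 e
  exact h ⟨_, hM', A', B', s', t', by rw [es, et, hst], rfl⟩

theorem Reduced.of_shuffleEquiv {L L' : List (Syllable G)}
    (h : ShuffleEquiv adj L L') (hL : Reduced adj L) : Reduced adj L' :=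
  fun ⟨M, hM, hA⟩ => hL ⟨M, h.trans hM, hA⟩

theorem Reduced.reverse (hsymm : ∀ ⦃I J⦄, adj I J → adj J I) {L : List (Syllable G)}
    (hL : Reduced adj L) : Reduced adj L.reverse := by
  rintro ⟨M, hM, A, B, s, t, hst, rfl⟩
  have := hM.reverse hsymm
  rw [List.reverse_reverse] at this
  exact hL ⟨_, this, B.reverse, A.reverse, t, s, hst.symm, by simp⟩

theorem Reduced.of_append_right {C L : List (Syllable G)} (h : Reduced adj (C ++ L)) :
    Reduced adj L := by
  rintro ⟨M, hM, A, B, s, t, hst, rfl⟩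
  exact h ⟨_, hM.append_left C, C ++ A, B, s, t, hst, by simp⟩

theorem reduced_nil : Reduced adj ([] : List (Syllable G)) := by
  rintro ⟨M, hM, A, B, s, t, hst, rfl⟩
  simpa using hM.perm.length_eq

theorem ShuffleEquiv.exists_of_cons {s : Syllable G}
    {A W : List (Syllable G)} (h : ShuffleEquiv adj (s :: A) W) :
    ∃ W₁ W₂, W = W₁ ++ s :: W₂ ∧ (∀ t ∈ W₁, adj s.1 t.1) ∧ ShuffleEquiv adj A (W₁ ++ W₂) := by
  induction h with
  | refl => exact ⟨[], A, rfl, by simp, .refl⟩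
  | tail _ h ih =>
    obtain ⟨X, Y, p, q, hpq, rfl, rfl⟩ := h
    obtain ⟨W₁, W₂, e, hW, hA⟩ := ih
    rcases List.append_eq_append_iff.1 e with ⟨Z, rfl, e'⟩ | ⟨Z, rfl, e'⟩
    · rcases List.cons_eq_append_iff.1 e' with ⟨rfl, e₂⟩ | ⟨Z, rfl, e₂⟩
      · simp only [List.cons.injEq] at e₂
        obtain ⟨rfl, rfl⟩ := e₂
        refine ⟨X ++ [q], Y, by simp, ?_, by simpa using hA⟩
        intro t ht
        rcases List.mem_append.1 ht with ht | ht
        · exact hW t (by simp [ht])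
        · rw [List.mem_singleton.1 ht]; exact hpq
      · rcases List.cons_eq_append_iff.1 e₂ with ⟨rfl, e₃⟩ | ⟨Z, rfl, rfl⟩
        · simp only [List.cons.injEq] at e₃
          obtain ⟨rfl, rfl⟩ := e₃
          exact ⟨X, p :: W₂, by simp, fun t ht => hW t (by simp [ht]), by simpa using hA⟩
        · refine ⟨X ++ q :: p :: Z, W₂, by simp, fun t ht => hW t ?_, hA.trans ?_⟩
          · simp at ht ⊢; tauto
          · exact .single ⟨X, Z ++ W₂, p, q, hpq, by simp, by simp⟩
    · rcases List.cons_eq_append_iff.1 e' with ⟨rfl, e₂⟩ | ⟨Z, rfl, rfl⟩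
      · simp only [List.cons.injEq] at e₂
        obtain ⟨rfl, rfl⟩ := e₂
        refine ⟨W₁ ++ [q], Y, by simp, ?_, by simpa using hA⟩
        intro t ht
        rcases List.mem_append.1 ht with ht | ht
        · exact hW t (by simp [ht])
        · rw [List.mem_singleton.1 ht]; exact hpq
      · refine ⟨W₁, Z ++ q :: p :: Y, by simp, hW, hA.trans ?_⟩
        exact .single ⟨W₁ ++ Z, Y, p, q, hpq, by simp, by simp⟩

/-- Levi's lemma for words up to shuffling. -/
theorem ShuffleEquiv.cons_cons (hsymm : ∀ ⦃I J⦄, adj I J → adj J I) {s t : Syllable G}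
    {A B : List (Syllable G)} (h : ShuffleEquiv adj (s :: A) (t :: B)) :
    (s = t ∧ ShuffleEquiv adj A B) ∨ (adj s.1 t.1 ∧
      ∃ C, ShuffleEquiv adj A (t :: C) ∧ ShuffleEquiv adj B (s :: C)) := by
  obtain ⟨W₁, W₂, e, hW, hA⟩ := h.exists_of_cons
  rcases List.cons_eq_append_iff.1 e with ⟨rfl, e₂⟩ | ⟨W, rfl, rfl⟩
  · simp only [List.cons.injEq] at e₂
    obtain ⟨rfl, rfl⟩ := e₂
    exact .inl ⟨rfl, hA⟩
  · refine .inr ⟨hW t (by simp), W ++ W₂, hA, ?_⟩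
    have h1 : ShuffleEquiv adj (s :: W) (W ++ [s]) :=
      shuffleEquiv_cons_of_adj fun t ht => hW t (by simp [ht])
    simpa using (h1.append_right W₂).symm hsymm

theorem reduced_cons_iff (hsymm : ∀ ⦃I J⦄, adj I J → adj J I) (hirr : ∀ I : Λ, ¬ adj I I)
    {s : Syllable G} {L : List (Syllable G)} : Reduced adj (s :: L) ↔
      Reduced adj L ∧ ∀ t M, ShuffleEquiv adj L (t :: M) → s.1 ≠ t.1 := by
  refine ⟨fun h => ⟨h.of_append_right (C := [s]), fun t M hM hst =>
    h ⟨_, hM.cons s, [], M, s, t, hst, rfl⟩⟩, ?_⟩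
  rintro ⟨hL, hs⟩ ⟨_, hM, P, Q, a, b, hab, rfl⟩
  obtain ⟨W₁, W₂, e, hW, hA⟩ := hM.exists_of_cons
  rcases List.append_eq_append_iff.1 e with ⟨Z, rfl, e'⟩ | ⟨Z, rfl, e'⟩
  · rcases List.cons_eq_append_iff.1 e' with ⟨rfl, e₂⟩ | ⟨Z, rfl, e₂⟩
    · simp only [List.cons.injEq] at e₂
      obtain ⟨rfl, rfl⟩ := e₂
      refine hs b (P ++ Q) (hA.trans ?_) hab
      have h1 : ShuffleEquiv adj (b :: P) (P ++ [b]) :=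
        shuffleEquiv_cons_of_adj fun t ht => hab ▸ hW t (by simp [ht])
      simpa using (h1.append_right Q).symm hsymm
    · rcases List.cons_eq_append_iff.1 e₂ with ⟨rfl, e₃⟩ | ⟨Z, rfl, rfl⟩
      · simp only [List.cons.injEq] at e₃
        obtain ⟨rfl, rfl⟩ := e₃
        exact hirr _ (hab ▸ hW a (by simp))
      · exact hL ⟨_, hA, P, Z ++ W₂, a, b, hab, by simp⟩
  · rcases List.cons_eq_append_iff.1 e' with ⟨rfl, e₂⟩ | ⟨Z, rfl, rfl⟩
    · simp only [List.cons.injEq] at e₂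
      obtain ⟨rfl, rfl⟩ := e₂
      refine hs b (W₁ ++ Q) (hA.trans ?_) hab
      have h1 : ShuffleEquiv adj (b :: W₁) (W₁ ++ [b]) :=
        shuffleEquiv_cons_of_adj fun t ht => hab ▸ hW t (by simp [ht])
      simpa using (h1.append_right Q).symm hsymm
    · exact hL ⟨_, hA, W₁ ++ Z, Q, a, b, hab, by simp⟩

theorem not_reduced_iff (hsymm : ∀ ⦃I J⦄, adj I J → adj J I) (hirr : ∀ I : Λ, ¬ adj I I)
    {L : List (Syllable G)} : ¬ Reduced adj L ↔
      ∃ P Q R s t, L = P ++ s :: (Q ++ t :: R) ∧ s.1 = t.1 ∧ ∀ q ∈ Q, adj s.1 q.1 := by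
  constructor
  · intro h
    induction L with
    | nil => exact absurd reduced_nil h
    | cons s L ih =>
      by_cases hL : Reduced adj L
      · rw [reduced_cons_iff hsymm hirr] at h
        push Not at h
        obtain ⟨t, M, hM, hst⟩ := h hL
        obtain ⟨Q, R, rfl, hQ, -⟩ := (hM.symm hsymm).exists_of_cons
        exact ⟨[], Q, R, s, t, rfl, hst, fun q hq => hst ▸ hQ q hq⟩
      · obtain ⟨P, Q, R, a, b, rfl, hab⟩ := ih hL
        exact ⟨s :: P, Q, R, a, b, rfl, hab⟩
  · rintro ⟨P, Q, R, s, t, rfl, hst, hQ⟩ h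
    refine h ⟨_, ((shuffleEquiv_cons_of_adj hQ).append_right (t :: R)).append_left P,
      P ++ Q, R, s, t, hst, by simp⟩

end Shuffle

section Trace

variable {Λ : Type u} {G : Λ → Type v} [∀ I, Group (G I)] {adj : Λ → Λ → Prop}

/-- Shuffle equivalence as a setoid. -/
def shuffleSetoid (G : Λ → Type v) [∀ I, Group (G I)] (hsymm : ∀ ⦃I J⦄, adj I J → adj J I) :
    Setoid (List (Syllable G)) where
  r := ShuffleEquiv adj
  iseqv := ⟨fun _ => .refl, fun h => h.symm hsymm, ShuffleEquiv.trans⟩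

/-- Words up to shuffling. -/
abbrev Trace (G : Λ → Type v) [∀ I, Group (G I)] (hsymm : ∀ ⦃I J⦄, adj I J → adj J I) :
    Type (max u v) :=
  Quotient (shuffleSetoid G hsymm)

namespace Trace

variable {hsymm : ∀ ⦃I J⦄, adj I J → adj J I}

/-- Put a syllable in front of a trace. -/
def cons (s : Syllable G) : Trace G hsymm → Trace G hsymm :=
  Quotient.map (s :: ·) fun _ _ h => ShuffleEquiv.cons s h

/-- Being reduced, for traces. -/
def IsReduced (x : Trace G hsymm) : Prop :=
  ∃ L, Reduced adj L ∧ (Quotient.mk _ L : Trace G hsymm) = x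

/-- No initial syllable of the trace `x` is at the vertex `I`. -/
def NotInitial (I : Λ) (x : Trace G hsymm) : Prop :=
  ∀ s y, x = cons s y → I ≠ s.1

theorem isReduced_mk {L : List (Syllable G)} :
    IsReduced (Quotient.mk _ L : Trace G hsymm) ↔ Reduced adj L :=
  ⟨fun ⟨_, hM, e⟩ => hM.of_shuffleEquiv (Quotient.exact e), fun h => ⟨L, h, rfl⟩⟩

theorem cons_comm {s t : Syllable G} (h : adj s.1 t.1) (x : Trace G hsymm) :
    cons s (cons t x) = cons t (cons s x) := by
  induction x using Quotient.inductionOn with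
  | h L => exact Quotient.sound (ShuffleEquiv.swap h L)

theorem cons_eq_cons {s t : Syllable G} {x y : Trace G hsymm} (h : cons s x = cons t y) :
    (s = t ∧ x = y) ∨ (adj s.1 t.1 ∧ ∃ z, x = cons t z ∧ y = cons s z) := by
  induction x using Quotient.inductionOn with
  | h A =>
    induction y using Quotient.inductionOn with
    | h B =>
      rcases ShuffleEquiv.cons_cons hsymm (Quotient.exact h) with ⟨e, h⟩ | ⟨e, C, h, h'⟩
      · exact .inl ⟨e, Quotient.sound h⟩
      · exact .inr ⟨e, Quotient.mk _ C, Quotient.sound h, Quotient.sound h'⟩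

theorem isReduced_cons (hirr : ∀ I : Λ, ¬ adj I I) {s : Syllable G} {x : Trace G hsymm} :
    IsReduced (cons s x) ↔ IsReduced x ∧ NotInitial s.1 x := by
  induction x using Quotient.inductionOn with
  | h L =>
    refine isReduced_mk.trans ((reduced_cons_iff hsymm hirr).trans ?_)
    refine and_congr isReduced_mk.symm ⟨fun h t y => ?_, fun h t M hM => ?_⟩
    · induction y using Quotient.inductionOn with
      | h M => exact fun e => h t M (Quotient.exact e)
    · exact h t (Quotient.mk _ M) (Quotient.sound hM)

open Classical in
/-- Put an element of a vertex group in front of a trace, omitting it if it is trivial. -/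
noncomputable def consOf (I : Λ) (g : G I) (x : Trace G hsymm) : Trace G hsymm :=
  if h : g = 1 then x else cons ⟨I, ⟨g, h⟩⟩ x

theorem consOf_one (I : Λ) (x : Trace G hsymm) : consOf I 1 x = x := by
  simp [consOf]

theorem consOf_of_ne_one {I : Λ} {g : G I} (h : g ≠ 1) (x : Trace G hsymm) :
    consOf I g x = cons ⟨I, ⟨g, h⟩⟩ x := by
  simp [consOf, h]

theorem exists_eq_consOf (hirr : ∀ I : Λ, ¬ adj I I) (I : Λ) {x : Trace G hsymm}
    (hx : IsReduced x) : ∃ g y, x = consOf I g y ∧ IsReduced y ∧ NotInitial I y := by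
  by_cases h : NotInitial I x
  · exact ⟨1, x, (consOf_one I x).symm, hx, h⟩
  · simp only [NotInitial, not_forall, not_not] at h
    obtain ⟨⟨J, g, hg⟩, y, rfl, rfl⟩ := h
    exact ⟨g, y, (consOf_of_ne_one hg y).symm, (isReduced_cons hirr).1 hx⟩

theorem consOf_inj (hirr : ∀ I : Λ, ¬ adj I I) {I : Λ} {g g' : G I} {x x' : Trace G hsymm}
    (hx : NotInitial I x) (hx' : NotInitial I x') (h : consOf I g x = consOf I g' x') :
    g = g' ∧ x = x' := by
  by_cases hg : g = 1 <;> by_cases hg' : g' = 1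
  · subst hg hg'
    simpa only [consOf_one, true_and] using h
  · rw [hg, consOf_one, consOf_of_ne_one hg'] at h
    exact absurd rfl (hx _ _ h)
  · rw [hg', consOf_one, consOf_of_ne_one hg] at h
    exact absurd rfl (hx' _ _ h.symm)
  · rw [consOf_of_ne_one hg, consOf_of_ne_one hg'] at h
    rcases cons_eq_cons h with ⟨e, e'⟩ | ⟨e, -⟩
    · simp only [Sigma.mk.injEq, heq_eq_eq, Subtype.mk.injEq, true_and] at e
      exact ⟨e, e'⟩
    · exact absurd e (hirr I)

theorem IsReduced.consOf (hirr : ∀ I : Λ, ¬ adj I I) {I : Λ} (g : G I) {x : Trace G hsymm}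
    (h : IsReduced x) (hx : NotInitial I x) : IsReduced (consOf I g x) := by
  by_cases hg : g = 1
  · rwa [hg, consOf_one]
  · rw [consOf_of_ne_one hg]
    exact (isReduced_cons hirr).2 ⟨h, hx⟩

theorem notInitial_consOf (hirr : ∀ I : Λ, ¬ adj I I) {I J : Λ} (hIJ : adj I J) {h : G J}
    {x : Trace G hsymm} : NotInitial I (Trace.consOf J h x) ↔ NotInitial I x := by
  by_cases hh : h = 1
  · rw [hh, consOf_one]
  rw [consOf_of_ne_one hh]
  constructor
  · rintro H s y rfl rfl
    exact H s _ (cons_comm (hsymm hIJ) y) rfl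
  · rintro H s y e rfl
    rcases cons_eq_cons e with ⟨rfl, -⟩ | ⟨-, z, rfl, -⟩
    · exact hirr _ hIJ
    · exact H _ _ rfl rfl

theorem consOf_comm {I J : Λ} (hIJ : adj I J) (g : G I) (h : G J) (x : Trace G hsymm) :
    Trace.consOf I g (Trace.consOf J h x) = Trace.consOf J h (Trace.consOf I g x) := by
  by_cases hg : g = 1
  · rw [hg, consOf_one, consOf_one]
  by_cases hh : h = 1
  · rw [hh, consOf_one, consOf_one]
  rw [consOf_of_ne_one hg, consOf_of_ne_one hh, consOf_of_ne_one hg, consOf_of_ne_one hh,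
    cons_comm hIJ]

/-- A reduced trace splits uniquely into its initial part at `I` and the rest. -/
noncomputable def splitEquiv (hsymm : ∀ ⦃I J⦄, adj I J → adj J I) (hirr : ∀ I : Λ, ¬ adj I I)
    (I : Λ) : G I × {x : Trace G hsymm // IsReduced x ∧ NotInitial I x} ≃
      {x : Trace G hsymm // IsReduced x} :=
  Equiv.ofBijective (fun p => ⟨Trace.consOf I p.1 p.2.1, p.2.2.1.consOf hirr p.1 p.2.2.2⟩) <| by
    constructor
    · rintro ⟨g, x, hx⟩ ⟨g', x', hx'⟩ h
      obtain ⟨rfl, rfl⟩ := consOf_inj hirr hx.2 hx'.2 (Subtype.ext_iff.1 h)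
      rfl
    · rintro ⟨x, hx⟩
      obtain ⟨g, y, rfl, hy⟩ := exists_eq_consOf hirr I hx
      exact ⟨⟨g, y, hy⟩, rfl⟩

/-- The action of a vertex group on the reduced traces. -/
noncomputable def vertexAction (hsymm : ∀ ⦃I J⦄, adj I J → adj J I) (hirr : ∀ I : Λ, ¬ adj I I)
    (I : Λ) : G I →* Function.End {x : Trace G hsymm // IsReduced x} where
  toFun g x := splitEquiv hsymm hirr I
    (g * ((splitEquiv hsymm hirr I).symm x).1, ((splitEquiv hsymm hirr I).symm x).2)
  map_one' := by
    funext x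
    simp only [one_mul, Prod.mk.eta, Equiv.apply_symm_apply]
    rfl
  map_mul' g h := by
    funext x
    show _ = splitEquiv hsymm hirr I _
    simp only [Equiv.symm_apply_apply, mul_assoc]

theorem vertexAction_consOf (hirr : ∀ I : Λ, ¬ adj I I) {I : Λ} (g h : G I)
    {x : Trace G hsymm} (hx : IsReduced x) (hI : NotInitial I x) :
    vertexAction hsymm hirr I g ⟨Trace.consOf I h x, hx.consOf hirr h hI⟩ =
      ⟨Trace.consOf I (g * h) x, hx.consOf hirr (g * h) hI⟩ := by
  have : (splitEquiv hsymm hirr I).symm ⟨Trace.consOf I h x, hx.consOf hirr h hI⟩ =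
      (h, ⟨x, hx, hI⟩) := (Equiv.symm_apply_eq _).2 rfl
  show splitEquiv hsymm hirr I _ = _
  rw [this]
  rfl

theorem vertexAction_commute (hirr : ∀ I : Λ, ¬ adj I I) {I J : Λ} (hIJ : adj I J)
    (g : G I) (h : G J) :
    Commute (vertexAction hsymm hirr I g) (vertexAction hsymm hirr J h) := by
  funext x
  obtain ⟨x, hx⟩ := x
  obtain ⟨g', y, rfl, hy, hIy⟩ := exists_eq_consOf hirr I hx
  obtain ⟨h', z, rfl, hz, hJz⟩ := exists_eq_consOf hirr J hy
  have hIz := (notInitial_consOf hirr hIJ).1 hIy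
  have hJz' (k : G I) : NotInitial J (Trace.consOf I k z) :=
    (notInitial_consOf hirr (hsymm hIJ)).2 hJz
  have hIz' (k : G J) : NotInitial I (Trace.consOf J k z) :=
    (notInitial_consOf hirr hIJ).2 hIz
  have hI (k : G I) (l : G J) (H) : vertexAction hsymm hirr I g
      ⟨Trace.consOf I k (Trace.consOf J l z), H⟩ = ⟨Trace.consOf I (g * k) (Trace.consOf J l z),
        (hz.consOf hirr l hJz).consOf hirr (g * k) (hIz' l)⟩ :=
    vertexAction_consOf hirr g k (hz.consOf hirr l hJz) (hIz' l)
  have hJ (k : G I) (l : G J) (H) : vertexAction hsymm hirr J h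
      ⟨Trace.consOf I k (Trace.consOf J l z), H⟩ = ⟨Trace.consOf I k (Trace.consOf J (h * l) z),
        (hz.consOf hirr (h * l) hJz).consOf hirr k (hIz' (h * l))⟩ := by
    simp only [consOf_comm hIJ]
    exact vertexAction_consOf hirr h l (hz.consOf hirr k hIz) (hJz' k)
  show vertexAction hsymm hirr I g (vertexAction hsymm hirr J h _) =
    vertexAction hsymm hirr J h (vertexAction hsymm hirr I g _)
  rw [hI, hJ, hJ, hI]

/-- The action of the graph product on the reduced traces. -/
noncomputable def action (hsymm : ∀ ⦃I J⦄, adj I J → adj J I) (hirr : ∀ I : Λ, ¬ adj I I) :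
    GraphProduct adj G →* Function.End {x : Trace G hsymm // IsReduced x} :=
  QuotientGroup.lift _ (Monoid.CoprodI.lift (vertexAction hsymm hirr)) <| by
    refine Subgroup.normalClosure_le_normal ?_
    rintro _ ⟨I, J, x, y, hIJ, rfl⟩
    simp only [SetLike.mem_coe, MonoidHom.mem_ker, map_mul, ← map_inv, Monoid.CoprodI.lift_of]
    rw [(vertexAction_commute hirr hIJ x y).eq, mul_assoc _ _ (vertexAction hsymm hirr I x⁻¹),
      ← map_mul, mul_inv_cancel, map_one, mul_one, ← map_mul, mul_inv_cancel, map_one]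

theorem action_mkOf (hirr : ∀ I : Λ, ¬ adj I I) {I : Λ} (g : G I) :
    action hsymm hirr (mkOf adj G g) = vertexAction hsymm hirr I g :=
  (QuotientGroup.lift_mk' _ _ _).trans (Monoid.CoprodI.lift_of _ _)

theorem action_evalWord (hirr : ∀ I : Λ, ¬ adj I I) {L : List (Syllable G)}
    (hL : Reduced adj L) :
    action hsymm hirr (evalWord adj G L) ⟨Quotient.mk _ [], isReduced_mk.2 reduced_nil⟩ =
      ⟨Quotient.mk _ L, isReduced_mk.2 hL⟩ := by
  induction L with
  | nil =>
    have : evalWord adj G [] = 1 := rfl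
    rw [this, map_one]
    rfl
  | cons s L ih =>
    obtain ⟨I, g, hg⟩ := s
    have h1 : evalWord adj G (⟨I, ⟨g, hg⟩⟩ :: L) = mkOf adj G g * evalWord adj G L := by
      simp [evalWord]
    have hL' := hL.of_append_right (C := [_])
    have hI : NotInitial I (Quotient.mk _ L : Trace G hsymm) :=
      ((isReduced_cons hirr (s := ⟨I, ⟨g, hg⟩⟩) (x := Quotient.mk _ L)).1 (isReduced_mk.2 hL)).2
    rw [h1, map_mul]
    show action hsymm hirr (mkOf adj G g) (action hsymm hirr _ _) = _
    rw [ih hL', action_mkOf]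
    have := vertexAction_consOf hirr g 1 (isReduced_mk.2 hL') hI
    simp only [consOf_one, mul_one, consOf_of_ne_one hg] at this
    exact this

end Trace

/-- The normal form theorem for graph products: reduced expressions for the same element
are shuffle equivalent. -/
theorem Reduced.shuffleEquiv_of_evalWord_eq (hsymm : ∀ ⦃I J⦄, adj I J → adj J I)
    (hirr : ∀ I : Λ, ¬ adj I I) {L L' : List (Syllable G)} (hL : Reduced adj L)
    (hL' : Reduced adj L') (h : evalWord adj G L = evalWord adj G L') : ShuffleEquiv adj L L' := by
  have h1 := Trace.action_evalWord (hsymm := hsymm) hirr hL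
  rw [h, Trace.action_evalWord hirr hL'] at h1
  exact (Quotient.exact (Subtype.ext_iff.1 h1)).symm hsymm

end Trace

section Quotients

variable {Λ : Type u} {G : Λ → Type v} [∀ I, Group (G I)] {adj : Λ → Λ → Prop}

theorem ShuffleEquiv.exists_of_concat (hsymm : ∀ ⦃I J⦄, adj I J → adj J I) {s : Syllable G}
    {A W : List (Syllable G)} (h : ShuffleEquiv adj (A ++ [s]) W) :
    ∃ W₁ W₂, W = W₁ ++ s :: W₂ ∧ ∀ t ∈ W₂, adj s.1 t.1 := by
  have h' := h.reverse hsymm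
  rw [List.reverse_append] at h'
  obtain ⟨W₁, W₂, e, hW, -⟩ := ShuffleEquiv.exists_of_cons h'
  refine ⟨W₂.reverse, W₁.reverse, ?_, fun t ht => hW t (by simpa using ht)⟩
  rw [← List.reverse_reverse W, e]
  simp

/-- Several final syllables of a word at different vertices can be shuffled to the end
simultaneously, and their vertices are pairwise adjacent. -/
theorem exists_shuffleEquiv_append (hsymm : ∀ ⦃I J⦄, adj I J → adj J I)
    {U : List (Syllable G)} (S : List (Syllable G)) (hS : (S.map Sigma.fst).Nodup)
    (h : ∀ s ∈ S, ∃ A, ShuffleEquiv adj U (A ++ [s])) :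
    ∃ A, ShuffleEquiv adj U (A ++ S) ∧ S.Pairwise fun s t => adj s.1 t.1 := by
  induction S with
  | nil => exact ⟨U, by simpa using .refl, .nil⟩
  | cons s S ih =>
    rw [List.map_cons, List.nodup_cons] at hS
    obtain ⟨A, hA, hS'⟩ := ih hS.2 fun t ht => h t (by simp [ht])
    obtain ⟨B, hB⟩ := h s (by simp)
    obtain ⟨W₁, W₂, e, hW⟩ := ((hB.symm hsymm).trans hA).exists_of_concat hsymm
    have hs : s ∉ S := fun hs => hS.1 (List.mem_map_of_mem hs)
    rcases List.append_eq_append_iff.1 e with ⟨Z, -, e'⟩ | ⟨Z, rfl, e'⟩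
    · exact absurd (by simp [e']) hs
    · rcases List.cons_eq_append_iff.1 e' with ⟨rfl, rfl⟩ | ⟨Z, rfl, rfl⟩
      · exact absurd (by simp) hs
      · refine ⟨W₁ ++ Z, hA.trans ?_, List.pairwise_cons.2 ⟨fun t ht => hW t (by simp [ht]), hS'⟩⟩
        have h1 : ShuffleEquiv adj (s :: Z) (Z ++ [s]) :=
          shuffleEquiv_cons_of_adj fun t ht => hW t (by simp [ht])
        simpa using (h1.append_left W₁).append_right S

theorem shuffleEquiv_concat_of_mem {A S : List (Syllable G)} {s : Syllable G} (hs : s ∈ S)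
    (hS : S.Pairwise fun s t => adj s.1 t.1) : ∃ X, ShuffleEquiv adj (A ++ S) (X ++ [s]) := by
  obtain ⟨P, Q, rfl⟩ := List.append_of_mem hs
  rw [List.pairwise_append, List.pairwise_cons] at hS
  refine ⟨A ++ P ++ Q, ?_⟩
  simpa using (shuffleEquiv_cons_of_adj hS.2.1.1).append_left (A ++ P)

theorem forall_mem_of_map_fst_eq {S S' : List (Syllable G)} {I : Λ}
    (h : S.map Sigma.fst = S'.map Sigma.fst) (hS : ∀ s ∈ S, adj I s.1) :
    ∀ s ∈ S', adj I s.1 := by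
  intro s hs
  have : s.1 ∈ S.map Sigma.fst := h ▸ List.mem_map_of_mem hs
  obtain ⟨t, ht, e⟩ := List.mem_map.1 this
  exact e ▸ hS t ht

/-- If `A S₁` and `S₂ B` are reduced, where `S`, `S₁`, `S₂` have the same vertices, among which
is every vertex that is both final in `A S₁` and initial in `S₂ B`, then `A S B` is reduced. -/
theorem reduced_append_append (hsymm : ∀ ⦃I J⦄, adj I J → adj J I) (hirr : ∀ I : Λ, ¬ adj I I)
    {A S S₁ S₂ B : List (Syllable G)} (e₁ : S.map Sigma.fst = S₁.map Sigma.fst)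
    (e₂ : S.map Sigma.fst = S₂.map Sigma.fst)
    (h₁ : Reduced adj (A ++ S₁)) (h₂ : Reduced adj (S₂ ++ B))
    (h : ∀ s t X Y, ShuffleEquiv adj (A ++ S₁) (X ++ [s]) → ShuffleEquiv adj (S₂ ++ B) (t :: Y) →
      s.1 = t.1 → s.1 ∈ S.map Sigma.fst) : Reduced adj (A ++ S ++ B) := by
  have h₁' : Reduced adj (A ++ S) := h₁.of_map_fst_eq (by simp [e₁])
  have h₂' : Reduced adj (S ++ B) := h₂.of_map_fst_eq (by simp [e₂])
  by_contra hn
  obtain ⟨P, Q, R, s, t, e, hst, hQ⟩ := (not_reduced_iff hsymm hirr).1 hn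
  have e : A ++ S ++ B = (P ++ s :: Q) ++ t :: R := by simpa using e
  have key : (∃ Q₂, P ++ s :: Q = A ++ S ++ Q₂ ∧ B = Q₂ ++ t :: R) ∨
      ∃ Z, A ++ S = P ++ s :: (Q ++ t :: Z) := by
    rcases List.append_eq_append_iff.1 e with ⟨Q₂, e', rfl⟩ | ⟨Z, e', e₃⟩
    · exact .inl ⟨Q₂, e', rfl⟩
    · rcases List.cons_eq_append_iff.1 e₃ with ⟨rfl, rfl⟩ | ⟨Z, rfl, rfl⟩
      · exact .inl ⟨[], by simpa using e'.symm, rfl⟩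
      · exact .inr ⟨Z, by simp [e']⟩
  rcases key with ⟨Q₂, e', rfl⟩ | ⟨Z, e'⟩
  · rcases List.append_eq_append_iff.1 e'.symm with ⟨Z, -, rfl⟩ | ⟨Z, e₃, e₄⟩
    · exact (not_reduced_iff hsymm hirr).2 ⟨S ++ Z, Q, R, s, t, by simp, hst, hQ⟩ h₂'
    · rcases List.cons_eq_append_iff.1 e₄ with ⟨rfl, rfl⟩ | ⟨Q₁, rfl, rfl⟩
      · exact (not_reduced_iff hsymm hirr).2 ⟨S, Q, R, s, t, by simp, hst, hQ⟩ h₂'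
      · rcases List.append_eq_append_iff.1 e₃ with ⟨Z, -, rfl⟩ | ⟨Z, rfl, e₅⟩
        · exact (not_reduced_iff hsymm hirr).2 ⟨Z, Q₁ ++ Q₂, R, s, t, by simp, hst, hQ⟩ h₂'
        · rcases List.cons_eq_append_iff.1 e₅ with ⟨rfl, rfl⟩ | ⟨Q₀, rfl, rfl⟩
          · exact (not_reduced_iff hsymm hirr).2 ⟨[], Q₁ ++ Q₂, R, s, t, by simp, hst, hQ⟩ h₂'
          · have hS : ∀ q ∈ S, adj s.1 q.1 := fun q hq => hQ q (by simp [hq])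
            have hS₁ := forall_mem_of_map_fst_eq e₁ hS
            have hS₂ := forall_mem_of_map_fst_eq e₂ hS
            have f₁ : ShuffleEquiv adj (s :: (Q₀ ++ S₁)) ((Q₀ ++ S₁) ++ [s]) :=
              shuffleEquiv_cons_of_adj fun q hq => by
                rcases List.mem_append.1 hq with hq | hq
                · exact hQ q (by simp [hq])
                · exact hS₁ q hq
            have f₂ : ShuffleEquiv adj (t :: (S₂ ++ Q₂)) ((S₂ ++ Q₂) ++ [t]) :=
              shuffleEquiv_cons_of_adj fun q hq => by
                rcases List.mem_append.1 hq with hq | hq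
                · exact hst ▸ hS₂ q hq
                · exact hst ▸ hQ q (by simp [hq])
            have := h s t (P ++ Q₀ ++ S₁) (S₂ ++ Q₂ ++ R)
              (by simpa using f₁.append_left P)
              (by simpa using (f₂.symm hsymm).append_right R) hst
            obtain ⟨q, hq, e⟩ := List.mem_map.1 this
            exact hirr _ (e ▸ hS q hq)
  · exact (not_reduced_iff hsymm hirr).2 ⟨P, Q, Z, s, t, e', hst, hQ⟩ h₁'

end Quotients

section Eval

variable {Λ : Type u} {G : Λ → Type v} [∀ I, Group (G I)] {adj : Λ → Λ → Prop}

theorem mkOf_mul {I : Λ} (x y : G I) :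
    mkOf adj G (x * y) = mkOf adj G x * mkOf adj G y := by
  simp only [mkOf, map_mul]
  rfl

theorem mkOf_one {I : Λ} : mkOf adj G (1 : G I) = 1 := by
  simp only [mkOf, map_one]
  rfl

theorem mkOf_inv {I : Λ} (x : G I) : mkOf adj G x⁻¹ = (mkOf adj G x)⁻¹ :=
  eq_inv_of_mul_eq_one_left (by rw [← mkOf_mul, inv_mul_cancel, mkOf_one])

theorem commute_mkOf {I J : Λ} (h : adj I J) (x : G I) (y : G J) :
    Commute (mkOf adj G x) (mkOf adj G y) := by
  have h1 : (QuotientGroup.mk (Monoid.CoprodI.of x * Monoid.CoprodI.of y *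
      (Monoid.CoprodI.of x)⁻¹ * (Monoid.CoprodI.of y)⁻¹) : GraphProduct adj G) = 1 :=
    (QuotientGroup.eq_one_iff _).2 (Subgroup.subset_normalClosure ⟨I, J, x, y, h, rfl⟩)
  have h2 : mkOf adj G x * mkOf adj G y * (mkOf adj G x)⁻¹ * (mkOf adj G y)⁻¹ = 1 := h1
  exact mul_inv_eq_iff_eq_mul.1 (mul_inv_eq_one.1 h2)

theorem evalWord_append (L M : List (Syllable G)) :
    evalWord adj G (L ++ M) = evalWord adj G L * evalWord adj G M := by
  simp [evalWord]

theorem evalWord_cons (s : Syllable G) (L : List (Syllable G)) :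
    evalWord adj G (s :: L) = mkOf adj G s.2.1 * evalWord adj G L := by
  simp [evalWord]

theorem evalWord_nil : evalWord adj G [] = 1 := rfl

theorem ShuffleEquiv.evalWord_eq {L L' : List (Syllable G)} (h : ShuffleEquiv adj L L') :
    evalWord adj G L = evalWord adj G L' := by
  induction h with
  | refl => rfl
  | tail _ h ih =>
    obtain ⟨A, B, s, t, hst, rfl, rfl⟩ := h
    rw [ih]
    simp only [evalWord_append, evalWord_cons]
    rw [(commute_mkOf hst _ _).left_comm]

theorem InitialAt.exists_shuffleEquiv (hsymm : ∀ ⦃I J⦄, adj I J → adj J I)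
    {L : List (Syllable G)} {i : Fin L.length} (h : InitialAt adj L i) :
    ∃ B, ShuffleEquiv adj L (L.get i :: B) := by
  have e : L = L.take i ++ L.get i :: L.drop (i + 1) := by simp
  refine ⟨L.take i ++ L.drop (i + 1), ?_⟩
  have h1 : ShuffleEquiv adj (L.get i :: L.take i) (L.take i ++ [L.get i]) := by
    refine shuffleEquiv_cons_of_adj fun t ht => ?_
    obtain ⟨j, hj, rfl⟩ := List.mem_iff_getElem.1 ht
    rw [List.length_take, lt_min_iff] at hj
    simpa using hsymm (h ⟨j, hj.2⟩ hj.1)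
  have h2 := (h1.symm hsymm).append_right (L.drop (i + 1))
  rw [List.append_assoc, List.singleton_append, ← e] at h2
  exact h2

theorem isFinalSyllable_iff (hsymm : ∀ ⦃I J⦄, adj I J → adj J I) {x : GraphProduct adj G}
    {s : Syllable G} : IsFinalSyllable adj G x s ↔
      ∃ A, Reduced adj (A ++ [s]) ∧ evalWord adj G (A ++ [s]) = x := by
  constructor
  · rintro ⟨L, hL, rfl, i, hi, rfl⟩
    obtain ⟨B, hB⟩ := hi.exists_shuffleEquiv hsymm
    have h := hB.reverse hsymm
    rw [List.reverse_reverse, List.reverse_cons] at h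
    exact ⟨B.reverse, hL.of_shuffleEquiv h, h.evalWord_eq.symm⟩
  · rintro ⟨A, hA, rfl⟩
    refine ⟨A ++ [s], hA, rfl, ⟨0, by simp⟩, fun j hj => ?_, by simp⟩
    exact absurd hj (by simp [Fin.lt_def])

theorem finalVertexOf_evalWord_iff (hsymm : ∀ ⦃I J⦄, adj I J → adj J I) (hirr : ∀ I : Λ, ¬ adj I I)
    {U : List (Syllable G)} (hU : Reduced adj U) {I : Λ} :
    FinalVertexOf adj G (evalWord adj G U) I ↔
      ∃ A s, ShuffleEquiv adj U (A ++ [s]) ∧ s.1 = I := by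
  simp only [FinalVertexOf, isFinalSyllable_iff hsymm]
  constructor
  · rintro ⟨s, ⟨A, hA, e⟩, rfl⟩
    exact ⟨A, s, hU.shuffleEquiv_of_evalWord_eq hsymm hirr hA e.symm, rfl⟩
  · rintro ⟨A, s, h, rfl⟩
    exact ⟨s, ⟨A, hU.of_shuffleEquiv h, h.evalWord_eq.symm⟩, rfl⟩

/-- The word consisting of the inverses of the syllables, in the reverse order. -/
def invWord (L : List (Syllable G)) : List (Syllable G) :=
  (L.map fun s => ⟨s.1, ⟨s.2.1⁻¹, inv_ne_one.2 s.2.2⟩⟩).reverse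

theorem evalWord_invWord (L : List (Syllable G)) :
    evalWord adj G (invWord L) = (evalWord adj G L)⁻¹ := by
  induction L with
  | nil => simp [invWord, evalWord]
  | cons s L ih =>
    have : invWord (s :: L) = invWord L ++ [⟨s.1, ⟨s.2.1⁻¹, inv_ne_one.2 s.2.2⟩⟩] := by
      simp [invWord]
    rw [this, evalWord_append, ih, evalWord_cons, evalWord_cons, evalWord_nil, mul_one,
      mul_inv_rev, mkOf_inv]

theorem Reduced.invWord (hsymm : ∀ ⦃I J⦄, adj I J → adj J I) {L : List (Syllable G)}
    (hL : Reduced adj L) : Reduced adj (invWord L) :=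
  (hL.of_map_fst_eq (by simp [Function.comp_def])).reverse hsymm

theorem finalVertexOf_inv_of_cons (hsymm : ∀ ⦃I J⦄, adj I J → adj J I) {t : Syllable G}
    {Y : List (Syllable G)} (h : Reduced adj (t :: Y)) :
    FinalVertexOf adj G (evalWord adj G (t :: Y))⁻¹ t.1 := by
  have e : invWord (t :: Y) = invWord Y ++ [⟨t.1, ⟨t.2.1⁻¹, inv_ne_one.2 t.2.2⟩⟩] := by
    simp [invWord]
  refine ⟨⟨t.1, ⟨t.2.1⁻¹, inv_ne_one.2 t.2.2⟩⟩, (isFinalSyllable_iff hsymm).2 ⟨invWord Y, ?_⟩, rfl⟩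
  rw [← e]
  exact ⟨h.invWord hsymm, evalWord_invWord _⟩

theorem map_fst_sylList (D : List Λ) (f : ∀ I : Λ, G I) (h : ∀ I ∈ D, f I ≠ 1) :
    (sylList D f h).map Sigma.fst = D := by
  simp [sylList, Function.comp_def]

theorem mem_sylList {D : List Λ} {f : ∀ I : Λ, G I} {h : ∀ I ∈ D, f I ≠ 1} {s : Syllable G} :
    s ∈ sylList D f h ↔ ∃ (I : Λ) (hI : I ∈ D), (⟨I, ⟨f I, h I hI⟩⟩ : Syllable G) = s := by
  simp [sylList]

theorem evalWord_sylList (D : List Λ) (f : ∀ I : Λ, G I) (h : ∀ I ∈ D, f I ≠ 1) :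
    evalWord adj G (sylList D f h) = (D.map fun I => mkOf adj G (f I)).prod := by
  rw [evalWord, sylList, List.map_map]
  conv_rhs => rw [← List.attach_map_subtype_val D, List.map_map]
  rfl

theorem prod_map_mkOf_mul {D : List Λ} (hD : D.Pairwise adj) (f g : ∀ I : Λ, G I) :
    (D.map fun I => mkOf adj G (f I * g I)).prod =
      (D.map fun I => mkOf adj G (f I)).prod * (D.map fun I => mkOf adj G (g I)).prod := by
  induction D with
  | nil => simp
  | cons I D ih =>
    rw [List.pairwise_cons] at hD
    have hc : Commute (mkOf adj G (g I)) (D.map fun J => mkOf adj G (f J)).prod := by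
      refine Commute.list_prod_right _ _ fun x hx => ?_
      obtain ⟨J, hJ, rfl⟩ := List.mem_map.1 hx
      exact commute_mkOf (hD.1 J hJ) _ _
    simp only [List.map_cons, List.prod_cons]
    rw [ih hD.2, mkOf_mul, mul_assoc, mul_assoc, hc.left_comm]

end Eval

section Positive

variable {Λ : Type u} {G : Λ → Type v} [∀ I, Group (G I)] {adj : Λ → Λ → Prop}
  {Pc : ∀ I, Submonoid (G I)}

/-- All syllables of the word are positive. -/
def PosWord (Pc : ∀ I, Submonoid (G I)) (L : List (Syllable G)) : Prop :=
  ∀ s ∈ L, (s.2.1 : G s.1) ∈ Pc s.1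

theorem mkOf_mem_posCone {I : Λ} {p : G I} (hp : p ∈ Pc I) : mkOf adj G p ∈ posCone adj G Pc :=
  Submonoid.subset_closure ⟨I, p, hp, rfl⟩

theorem PosWord.append {L M : List (Syllable G)} (hL : PosWord Pc L) (hM : PosWord Pc M) :
    PosWord Pc (L ++ M) := fun s hs =>
  (List.mem_append.1 hs).elim (hL s) (hM s)

theorem PosWord.of_subset {L M : List (Syllable G)} (hL : PosWord Pc L) (h : M ⊆ L) :
    PosWord Pc M := fun s hs => hL s (h hs)

theorem PosWord.evalWord_mem {L : List (Syllable G)} (hL : PosWord Pc L) :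
    evalWord adj G L ∈ posCone adj G Pc := by
  refine Submonoid.list_prod_mem _ fun x hx => ?_
  obtain ⟨s, hs, rfl⟩ := List.mem_map.1 hx
  exact mkOf_mem_posCone (hL s hs)

open Classical in
/-- The word of length at most one representing an element of one of the groups. -/
noncomputable def wordOf {I : Λ} (g : G I) : List (Syllable G) :=
  if h : g = 1 then [] else [⟨I, ⟨g, h⟩⟩]

theorem wordOf_one {I : Λ} : wordOf (1 : G I) = [] := dif_pos rfl

theorem wordOf_of_ne_one {I : Λ} {g : G I} (h : g ≠ 1) : wordOf g = [⟨I, ⟨g, h⟩⟩] := dif_neg h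

theorem length_wordOf_le {I : Λ} (g : G I) : (wordOf g).length ≤ 1 := by
  by_cases h : g = 1
  · simp [h, wordOf_one]
  · simp [wordOf_of_ne_one h]

theorem evalWord_wordOf {I : Λ} (g : G I) : evalWord adj G (wordOf g) = mkOf adj G g := by
  by_cases h : g = 1
  · rw [h, wordOf_one, mkOf_one, evalWord_nil]
  · rw [wordOf_of_ne_one h, evalWord_cons, evalWord_nil, mul_one]

theorem posWord_wordOf {I : Λ} {g : G I} (hg : g ∈ Pc I) : PosWord Pc (wordOf g) := by
  by_cases h : g = 1
  · simp [h, wordOf_one, PosWord]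
  · simpa [wordOf_of_ne_one h, PosWord] using hg

theorem exists_posWord {x : GraphProduct adj G} (hx : x ∈ posCone adj G Pc) :
    ∃ L, PosWord Pc L ∧ evalWord adj G L = x := by
  induction hx using Submonoid.closure_induction with
  | mem x hx =>
    obtain ⟨I, p, hp, rfl⟩ := hx
    exact ⟨wordOf p, posWord_wordOf hp, evalWord_wordOf p⟩
  | one => exact ⟨[], by simp [PosWord], rfl⟩
  | mul x y _ _ hx hy =>
    obtain ⟨L, hL, rfl⟩ := hx
    obtain ⟨M, hM, rfl⟩ := hy
    exact ⟨L ++ M, hL.append hM, evalWord_append L M⟩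

theorem PosWord.exists_length_lt {L : List (Syllable G)} (hL : PosWord Pc L)
    (hr : ¬ Reduced adj L) :
    ∃ L', PosWord Pc L' ∧ evalWord adj G L' = evalWord adj G L ∧ L'.length < L.length := by
  obtain ⟨M, hM, A, B, ⟨I, g, hg⟩, ⟨J, g', hg'⟩, hIJ, rfl⟩ := not_not.1 hr
  obtain rfl : I = J := hIJ
  have hpos := hL.of_subset hM.perm.symm.subset
  have hgp : g ∈ Pc I := hpos ⟨I, ⟨g, hg⟩⟩ (by simp)
  have hgp' : g' ∈ Pc I := hpos ⟨I, ⟨g', hg'⟩⟩ (by simp)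
  refine ⟨A ++ wordOf (g * g') ++ B, ((hpos.of_subset (by simp)).append
    (posWord_wordOf (mul_mem hgp hgp'))).append (hpos.of_subset ?_), ?_, ?_⟩
  · exact fun s hs => by simp [hs]
  · rw [hM.evalWord_eq]
    simp only [evalWord_append, evalWord_cons, evalWord_wordOf, mkOf_mul, mul_assoc]
  · have := length_wordOf_le (g * g')
    rw [hM.perm.length_eq]
    simp only [List.length_append, List.length_cons]
    omega

end Positive

section QuasiLattice

variable {H : Type*} [Group H] {P : Submonoid H}

theorem IsQLO.exists_isRGlb_one (h : IsQLO P) {x y : H} (hx : x ∈ P) (hy : y ∈ P) :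
    ∃ k ∈ P, x * k⁻¹ ∈ P ∧ y * k⁻¹ ∈ P ∧ IsRGlb P (x * k⁻¹) (y * k⁻¹) 1 := by
  obtain ⟨m, h1, h2, h3⟩ := h.2 1 (x * y⁻¹) ⟨x, by simpa [lle] using hx, by simpa [lle] using hy⟩
  have ex : x * (m⁻¹ * x)⁻¹ = m := by group
  have ey : y * (m⁻¹ * x)⁻¹ = (x * y⁻¹)⁻¹ * m := by group
  have hm : m ∈ P := by simpa [lle] using h1
  refine ⟨m⁻¹ * x, h3 x (by simpa [lle] using hx) (by simpa [lle] using hy), ?_⟩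
  rw [ex, ey]
  refine ⟨hm, h2, by simpa [rle] using hm, by simpa [rle, lle] using h2, fun z hz hz' => ?_⟩
  have := h3 (m * z⁻¹) (by simpa [lle, rle] using hz) (by simpa [lle, rle, mul_assoc] using hz')
  simpa [lle, rle] using this

theorem IsPoGroup.eq_one_of_isRGlb_self (h : IsPoGroup P) {x : H} (hx : x ∈ P)
    (hg : IsRGlb P x x 1) : x = 1 :=
  h x hx (by simpa [rle] using hg.2.2 x (by simp [rle]) (by simp [rle]))

end QuasiLattice

section QuotientPair

variable {Λ : Type u} {G : Λ → Type v} [∀ I, Group (G I)] {adj : Λ → Λ → Prop}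
  {Pc : ∀ I, Submonoid (G I)}

/-- `U` and `V` are positive words, and `u` and `v` are obtained from them by multiplication on
the right by a common positive element. -/
def IsCommonQuotient (adj : Λ → Λ → Prop) (Pc : ∀ I, Submonoid (G I)) (u v : GraphProduct adj G)
    (U V : List (Syllable G)) : Prop :=
  PosWord Pc U ∧ PosWord Pc V ∧
    ∃ c ∈ posCone adj G Pc, evalWord adj G U * c = u ∧ evalWord adj G V * c = v

theorem exists_minimal_isCommonQuotient {u v : GraphProduct adj G} (hu : u ∈ posCone adj G Pc)
    (hv : v ∈ posCone adj G Pc) :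
    ∃ U V, IsCommonQuotient adj Pc u v U V ∧ ∀ U' V', IsCommonQuotient adj Pc u v U' V' →
      U.length + V.length ≤ U'.length + V'.length := by
  classical
  have h : ∃ n U V, IsCommonQuotient adj Pc u v U V ∧ U.length + V.length = n := by
    obtain ⟨U, hU, rfl⟩ := exists_posWord hu
    obtain ⟨V, hV, rfl⟩ := exists_posWord hv
    exact ⟨_, U, V, ⟨hU, hV, 1, one_mem _, mul_one _, mul_one _⟩, rfl⟩
  obtain ⟨U, V, hUV, e⟩ := Nat.find_spec h
  exact ⟨U, V, hUV, fun X Y hXY => e ▸ Nat.find_min' h ⟨X, Y, hXY, rfl⟩⟩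

/-- In a minimal pair, dividing the final syllables at a common vertex by their greatest lower
bound leaves nontrivial elements. -/
theorem exists_common_right_factor_of_minimal (hqlo : ∀ I, IsQLO (Pc I))
    {u v : GraphProduct adj G} {U V : List (Syllable G)} (hUV : IsCommonQuotient adj Pc u v U V)
    (hmin : ∀ U' V', IsCommonQuotient adj Pc u v U' V' →
      U.length + V.length ≤ U'.length + V'.length) {I : Λ}
    (hU : ∃ A s, ShuffleEquiv adj U (A ++ [s]) ∧ s.1 = I)
    (hV : ∃ B t, ShuffleEquiv adj V (B ++ [t]) ∧ t.1 = I) :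
    ∃ (f g k : G I) (hfk : f * k ≠ 1) (hgk : g * k ≠ 1),
      (∃ A, ShuffleEquiv adj U (A ++ [⟨I, ⟨f * k, hfk⟩⟩])) ∧
      (∃ B, ShuffleEquiv adj V (B ++ [⟨I, ⟨g * k, hgk⟩⟩])) ∧
      f ∈ Pc I ∧ g ∈ Pc I ∧ k ∈ Pc I ∧ f ≠ 1 ∧ g ≠ 1 ∧ IsRGlb (Pc I) f g 1 := by
  obtain ⟨A, ⟨I, x, hx⟩, hA, rfl⟩ := hU
  obtain ⟨B, ⟨J, y, hy⟩, hB, e⟩ := hV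
  obtain rfl : J = I := e
  obtain ⟨hpU, hpV, c, hc, rfl, rfl⟩ := hUV
  have hpA := hpU.of_subset hA.perm.symm.subset
  have hpB := hpV.of_subset hB.perm.symm.subset
  obtain ⟨k, hk, hf, hg, hglb⟩ := (hqlo J).exists_isRGlb_one
    (hpA ⟨J, ⟨x, hx⟩⟩ (by simp)) (hpB ⟨J, ⟨y, hy⟩⟩ (by simp))
  have hlen := hmin (A ++ wordOf (x * k⁻¹)) (B ++ wordOf (y * k⁻¹))
    ⟨(hpA.of_subset (by simp)).append (posWord_wordOf hf),
      (hpB.of_subset (by simp)).append (posWord_wordOf hg),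
      mkOf adj G k * c, mul_mem (mkOf_mem_posCone hk) hc,
      by simp [hA.evalWord_eq, evalWord_append, evalWord_cons, evalWord_nil, evalWord_wordOf,
        mkOf_mul, mkOf_inv, mul_assoc],
      by simp [hB.evalWord_eq, evalWord_append, evalWord_cons, evalWord_nil, evalWord_wordOf,
        mkOf_mul, mkOf_inv, mul_assoc]⟩
  rw [hA.perm.length_eq, hB.perm.length_eq] at hlen
  simp only [List.length_append, List.length_singleton] at hlen
  have h1 := length_wordOf_le (x * k⁻¹)
  have h2 := length_wordOf_le (y * k⁻¹)
  refine ⟨x * k⁻¹, y * k⁻¹, k, by simpa using hx, by simpa using hy, ⟨A, by simpa using hA⟩,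
    ⟨B, by simpa using hB⟩, hf, hg, hk, fun h => ?_, fun h => ?_, hglb⟩
  · simp only [h, wordOf_one, List.length_nil] at hlen
    omega
  · simp only [h, wordOf_one, List.length_nil] at hlen
    omega

theorem posWord_sylList {D : List Λ} {f : ∀ I : Λ, G I} (h : ∀ I ∈ D, f I ≠ 1)
    (hf : ∀ I ∈ D, f I ∈ Pc I) : PosWord Pc (sylList D f h) := by
  intro s hs
  obtain ⟨I, hI, rfl⟩ := mem_sylList.1 hs
  exact hf I hI

theorem prod_map_mkOf_mem_posCone {D : List Λ} {f : ∀ I : Λ, G I}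
    (hf : ∀ I ∈ D, f I ∈ Pc I) : (D.map fun I => mkOf adj G (f I)).prod ∈ posCone adj G Pc := by
  refine Submonoid.list_prod_mem _ fun x hx => ?_
  obtain ⟨I, hI, rfl⟩ := List.mem_map.1 hx
  exact mkOf_mem_posCone (hf I hI)

theorem pairwise_sylList {D : List Λ} {f : ∀ I : Λ, G I} {h : ∀ I ∈ D, f I ≠ 1} :
    ((sylList D f h).Pairwise fun s t => adj s.1 t.1) ↔ D.Pairwise adj := by
  rw [← List.pairwise_map (f := Sigma.fst) (R := adj), map_fst_sylList]

/-- Dividing the final syllables at the vertices of `D` by `k I` does not affect reducedness and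
final vertices. -/
theorem exists_divide_final (hsymm : ∀ ⦃I J⦄, adj I J → adj J I) (hirr : ∀ I : Λ, ¬ adj I I)
    {U : List (Syllable G)} (hU : Reduced adj U) (hpU : PosWord Pc U) {D : List Λ} (hD : D.Nodup)
    {f k : ∀ I : Λ, G I} (hf : ∀ I ∈ D, f I ≠ 1) (hfP : ∀ I ∈ D, f I ∈ Pc I)
    (hfk : ∀ I ∈ D, f I * k I ≠ 1)
    (h : ∀ (I : Λ) (hI : I ∈ D), ∃ A, ShuffleEquiv adj U (A ++ [⟨I, ⟨f I * k I, hfk I hI⟩⟩])) :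
    ∃ a ∈ posCone adj G Pc, a * (D.map fun I => mkOf adj G (k I)).prod = evalWord adj G U ∧
      D.Pairwise adj ∧
      (∀ (I : Λ) (hI : I ∈ D), IsFinalSyllable adj G a ⟨I, ⟨f I, hf I hI⟩⟩) ∧
      ∀ I, FinalVertexOf adj G a I → ∃ A s, ShuffleEquiv adj U (A ++ [s]) ∧ s.1 = I := by
  obtain ⟨A, hA, hpw⟩ := exists_shuffleEquiv_append hsymm
    (sylList D (fun I => f I * k I) hfk) (by rwa [map_fst_sylList]) (U := U) (fun s hs => by
      obtain ⟨I, hI, rfl⟩ := mem_sylList.1 hs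
      exact h I hI)
  rw [pairwise_sylList] at hpw
  have e : (A ++ sylList D (fun I => f I * k I) hfk).map Sigma.fst =
      (A ++ sylList D f hf).map Sigma.fst := by simp only [List.map_append, map_fst_sylList]
  have hr : Reduced adj (A ++ sylList D f hf) := (hU.of_shuffleEquiv hA).of_map_fst_eq e
  refine ⟨evalWord adj G (A ++ sylList D f hf), ?_, ?_, hpw, fun I hI => ?_, fun I hI => ?_⟩
  · exact (((hpU.of_subset hA.perm.symm.subset).of_subset (by simp)).append
      (posWord_sylList hf hfP)).evalWord_mem
  · rw [hA.evalWord_eq, evalWord_append, evalWord_append, evalWord_sylList, evalWord_sylList,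
      prod_map_mkOf_mul hpw, mul_assoc]
  · obtain ⟨X, hX⟩ := shuffleEquiv_concat_of_mem (A := A) (mem_sylList (h := hf).2 ⟨I, hI, rfl⟩)
      (pairwise_sylList.2 hpw)
    exact (isFinalSyllable_iff hsymm).2 ⟨X, hr.of_shuffleEquiv hX, hX.evalWord_eq.symm⟩
  · obtain ⟨X, s, hX, rfl⟩ := (finalVertexOf_evalWord_iff hsymm hirr hr).1 hI
    obtain ⟨M, hM, e'⟩ := hX.exists_lift e.symm
    rw [List.map_append, List.map_singleton] at e'
    obtain ⟨Y, T, rfl, -, hT⟩ := List.map_eq_append_iff.1 e'.symm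
    obtain ⟨t, rfl, ht⟩ := List.map_eq_singleton_iff.1 hT
    exact ⟨Y, t, hA.trans hM, ht⟩

/-- If `D` consists of the common final vertices of `a` and `b`, then a reduced expression of
`a * b⁻¹` is obtained by multiplying the corresponding final syllables. -/
theorem reduced_and_exprFor_mul_inv (hsymm : ∀ ⦃I J⦄, adj I J → adj J I)
    (hirr : ∀ I : Λ, ¬ adj I I) {a b : GraphProduct adj G} {D : List Λ}
    (hD : ∀ I, FinalVertexOf adj G a I → FinalVertexOf adj G b I → I ∈ D) (hpw : D.Pairwise adj)
    {f g : ∀ I : Λ, G I} (hf : ∀ I ∈ D, f I ≠ 1) (hg : ∀ I ∈ D, g I ≠ 1)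
    (hfg : ∀ I ∈ D, f I * g I ≠ 1) {A B : List (Syllable G)}
    (hA : Reduced adj (A ++ sylList D f hf)) (ea : ExprFor adj G (A ++ sylList D f hf) a)
    (hB : Reduced adj (sylList D g hg ++ B)) (eb : ExprFor adj G (sylList D g hg ++ B) b⁻¹) :
    Reduced adj (A ++ sylList D (fun I => f I * g I) hfg ++ B) ∧
      ExprFor adj G (A ++ sylList D (fun I => f I * g I) hfg ++ B) (a * b⁻¹) := by
  unfold ExprFor at ea eb ⊢
  constructor
  · refine reduced_append_append hsymm hirr (by simp only [map_fst_sylList])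
      (by simp only [map_fst_sylList]) hA hB fun s t X Y hX hY hst => ?_
    rw [map_fst_sylList]
    refine hD _ (ea ▸ (finalVertexOf_evalWord_iff hsymm hirr hA).2 ⟨X, s, hX, rfl⟩) ?_
    have := finalVertexOf_inv_of_cons hsymm (hB.of_shuffleEquiv hY)
    rwa [← hY.evalWord_eq, eb, inv_inv, ← hst] at this
  · rw [← ea, ← eb]
    simp only [evalWord_append, evalWord_sylList, prod_map_mkOf_mul hpw, mul_assoc]

end QuotientPair

/-- Lemma `red-quot`. Let `(G,P)` be a graph product of quasi-lattice
ordered groups.  For every pair `u, v ∈ P` there are `a, b ∈ P` with: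
(i) `ab⁻¹ = uv⁻¹`, `a ≤ u`, `b ≤ v` and `a_Iʳ ∧ᵣ b_Iʳ = 1` in `(G_I, P_I)` for every
`I ∈ Δʳ(a) ∩ Δʳ(b)` (the intersection being enumerated by a duplicate-free list `Ds`,
with `ar I = a_Iʳ` and `br I = b_Iʳ` the final syllables of `a` and `b`); and
(ii) whenever `A ++ ∏_{I ∈ Ds} a_Iʳ` is a reduced expression for `a` and
`(∏_{I ∈ Ds} (b_Iʳ)⁻¹) ++ B` is a reduced expression for `b⁻¹`, the word
`A ++ (∏_{I ∈ Ds} a_Iʳ (b_Iʳ)⁻¹) ++ B` is a reduced expression for `ab⁻¹`. -/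
theorem exists_reduced_quotient_pair {Λ : Type u} (adj : Λ → Λ → Prop)
    (hsymm : Symmetric adj) (hirr : ∀ I : Λ, ¬ adj I I)
    (G : Λ → Type v) [∀ I, Group (G I)]
    (Pc : ∀ I, Submonoid (G I)) (hqlo : ∀ I, IsQLO (Pc I))
    (u v : GraphProduct adj G)
    (hu : u ∈ posCone adj G Pc) (hv : v ∈ posCone adj G Pc) :
    ∃ a b : GraphProduct adj G, a ∈ posCone adj G Pc ∧ b ∈ posCone adj G Pc ∧
      a * b⁻¹ = u * v⁻¹ ∧
      lle (posCone adj G Pc) a u ∧ lle (posCone adj G Pc) b v ∧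
      ∃ Ds : List Λ, Ds.Nodup ∧
        (∀ I : Λ, I ∈ Ds ↔ (FinalVertexOf adj G a I ∧ FinalVertexOf adj G b I)) ∧
        ∃ (ar br : ∀ I : Λ, G I)
          (har1 : ∀ I ∈ Ds, ar I ≠ 1) (hbr1 : ∀ I ∈ Ds, br I ≠ 1),
          (∀ (I : Λ) (h : I ∈ Ds), IsFinalSyllable adj G a ⟨I, ⟨ar I, har1 I h⟩⟩) ∧
          (∀ (I : Λ) (h : I ∈ Ds), IsFinalSyllable adj G b ⟨I, ⟨br I, hbr1 I h⟩⟩) ∧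
          (∀ I ∈ Ds, IsRGlb (Pc I) (ar I) (br I) 1) ∧
          ∃ hz : ∀ I ∈ Ds, ar I * (br I)⁻¹ ≠ 1,
            ∀ A B : List (Syllable G),
              Reduced adj (A ++ sylList Ds ar har1) →
              ExprFor adj G (A ++ sylList Ds ar har1) a →
              Reduced adj
                (sylList Ds (fun I => (br I)⁻¹) (fun I h => inv_ne_one.mpr (hbr1 I h)) ++ B) →
              ExprFor adj G
                (sylList Ds (fun I => (br I)⁻¹) (fun I h => inv_ne_one.mpr (hbr1 I h)) ++ B)
                b⁻¹ →
              Reduced adj (A ++ sylList Ds (fun I => ar I * (br I)⁻¹) hz ++ B) ∧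
              ExprFor adj G (A ++ sylList Ds (fun I => ar I * (br I)⁻¹) hz ++ B)
                (a * b⁻¹) := by
  classical
  have hs : ∀ ⦃I J⦄, adj I J → adj J I := fun _ _ h => hsymm h
  obtain ⟨U, V, hUV, hmin⟩ := exists_minimal_isCommonQuotient hu hv
  obtain ⟨hpU, hpV, c, hc, hUc, hVc⟩ := id hUV
  have hU : Reduced adj U := by
    by_contra hr
    obtain ⟨U', hU', e, hlt⟩ := hpU.exists_length_lt hr
    have := hmin U' V ⟨hU', hpV, c, hc, by rw [e, hUc], hVc⟩
    omega
  have hV : Reduced adj V := by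
    by_contra hr
    obtain ⟨V', hV', e, hlt⟩ := hpV.exists_length_lt hr
    have := hmin U V' ⟨hpU, hV', c, hc, hUc, by rw [e, hVc]⟩
    omega
  let F : List (Syllable G) → Λ → Prop := fun W I =>
    ∃ A s, ShuffleEquiv adj W (A ++ [s]) ∧ s.1 = I
  obtain ⟨D, hDn, hD⟩ : ∃ D : List Λ, D.Nodup ∧ ∀ I, I ∈ D ↔ F U I ∧ F V I := by
    refine ⟨((U.map Sigma.fst).dedup).filter fun I => F U I ∧ F V I,
      (List.nodup_dedup _).filter _, fun I => ?_⟩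
    rw [List.mem_filter, List.mem_dedup, decide_eq_true_iff, and_iff_right_iff_imp]
    rintro ⟨⟨A, s, hA, rfl⟩, -⟩
    exact List.mem_map_of_mem (hA.perm.mem_iff.2 (by simp))
  have key : ∀ I, ∃ f g k : G I, I ∈ D → ∃ (hfk : f * k ≠ 1) (hgk : g * k ≠ 1),
      (∃ A, ShuffleEquiv adj U (A ++ [⟨I, ⟨f * k, hfk⟩⟩])) ∧
      (∃ B, ShuffleEquiv adj V (B ++ [⟨I, ⟨g * k, hgk⟩⟩])) ∧
      f ∈ Pc I ∧ g ∈ Pc I ∧ k ∈ Pc I ∧ f ≠ 1 ∧ g ≠ 1 ∧ IsRGlb (Pc I) f g 1 := by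
    intro I
    by_cases hI : I ∈ D
    · obtain ⟨f, g, k, h⟩ := exists_common_right_factor_of_minimal hqlo hUV hmin
        ((hD I).1 hI).1 ((hD I).1 hI).2
      exact ⟨f, g, k, fun _ => h⟩
    · exact ⟨1, 1, 1, fun h => absurd h hI⟩
  choose f g k hfk hgk hfU hgV hfP hgP hkP hf hg hglb using key
  obtain ⟨a, ha, ea, hpw, hfa, hFa⟩ := exists_divide_final hs hirr hU hpU hDn hf hfP hfk hfU
  obtain ⟨b, hb, eb, -, hgb, hFb⟩ := exists_divide_final hs hirr hV hpV hDn hg hgP hgk hgV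
  have hK := mul_mem (prod_map_mkOf_mem_posCone (adj := adj) hkP) hc
  rw [← ea, mul_assoc] at hUc
  rw [← eb, mul_assoc] at hVc
  refine ⟨a, b, ha, hb, ?_, ?_, ?_, D, hDn,
    fun I => ⟨fun hI => ⟨⟨_, hfa I hI, rfl⟩, ⟨_, hgb I hI, rfl⟩⟩,
      fun h => (hD I).2 ⟨hFa I h.1, hFb I h.2⟩⟩,
    f, g, hf, hg, hfa, hgb, hglb, fun I hI h => ?_, fun A B hA eA hB eB => ?_⟩
  · rw [← hUc, ← hVc]
    group
  · rwa [lle, ← hUc, inv_mul_cancel_left]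
  · rwa [lle, ← hVc, inv_mul_cancel_left]
  · have h' := hglb I hI
    rw [← mul_inv_eq_one.1 h] at h'
    exact hf I hI ((hqlo I).1.eq_one_of_isRGlb_self (hfP I hI) h')
  · exact reduced_and_exprFor_mul_inv hs hirr (fun I h h' => (hD I).2 ⟨hFa I h, hFb I h'⟩) hpw
      hf _ _ hA eA hB eB
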